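/- Let Q_v ∈ Ḣ^{1/2}(ℝ; ℝ³) and let Q_v^e be its bounded harmonic Poisson extension to the upper half-plane ℝ²₊. If |v| ≥ 1 and the Pohozaev identity v ∬_{ℝ²₊} (|∂_x Q_v^e|² + |∂_y Q_v^e|²) dx dy = 2 ∬_{ℝ²₊} (Q_v^e × ∂_x Q_v^e) · ∂_y Q_v^e dx dy holds, then, using the pointwise bound |Q_v^e| ≤ 1 (valid when |Q_v| = 1 a.e. on ℝ by the maximum principle) and the Cauchy–Schwarz estimate 2|(a × b) · c| ≤ |a|(|b|² + |c|²) for a, b, c ∈ ℝ³, one concludes ∂_x Q_v^e ≡ 0 and ∂_y Q_v^e ≡ 0 on ℝ²₊, hence Q_v is constant almost everywhere on ℝ. -/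

import Mathlib

/-!
Rigidity from the Pohozaev identity for speeds `|v| ≥ 1`: combining the identity
with the pointwise bound `|Q^e| ≤ 1` and the Cauchy–Schwarz estimate
`2|(a×b)·c| ≤ |a|(|b|² + |c|²)` forces the Poisson extension to be constant,
hence `Q` is constant almost everywhere.
-/

open MeasureTheory Filter
open scoped ENNReal Topology

noncomputable section

/-- Vectors in ℝ³. -/
abbrev V3 : Type := Fin 3 → ℝ

/-- Euclidean dot product on ℝ³. -/
def dot3 (a b : V3) : ℝ := ∑ i, a i * b i

/-- Cross product on ℝ³. -/
def cross3 (a b : V3) : V3 := crossProduct a b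

/-- The bounded harmonic (Poisson) extension of `Q : ℝ → ℝ³` to the upper
half-plane: `Qᵉ(x,y) = (1/π) ∫ y/((x-t)² + y²) · Q(t) dt`. -/
def poissonExt (Q : ℝ → V3) (x y : ℝ) : V3 :=
  (Real.pi)⁻¹ • ∫ t : ℝ, (y / ((x - t) ^ 2 + y ^ 2)) • Q t

/-- The unnormalised Poisson kernel `y / (s² + y²)`. -/
def poissonKer (s y : ℝ) : ℝ := y / (s ^ 2 + y ^ 2)

/-- The derivative of `poissonKer` in its first variable. -/
def poissonKerDx (s y : ℝ) : ℝ := -(2 * s * y) / (s ^ 2 + y ^ 2) ^ 2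

/-- The derivative of `poissonKer` in its second variable. -/
def poissonKerDy (s y : ℝ) : ℝ := (s ^ 2 - y ^ 2) / (s ^ 2 + y ^ 2) ^ 2

/-- The integral of `f` against the translate to `x` of the kernel `K` at height `y`. -/
def kerInt (K : ℝ → ℝ → ℝ) (f : ℝ → ℝ) (x y : ℝ) : ℝ := ∫ t : ℝ, K (x - t) y * f t

lemma sq_add_sq_pos_of_pos (s : ℝ) {y : ℝ} (hy : 0 < y) : 0 < s ^ 2 + y ^ 2 := by positivity

lemma measurable_poissonKer : Measurable fun p : ℝ × ℝ => poissonKer p.1 p.2 := by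
  unfold poissonKer; fun_prop

lemma measurable_poissonKerDx : Measurable fun p : ℝ × ℝ => poissonKerDx p.1 p.2 := by
  unfold poissonKerDx; fun_prop

lemma measurable_poissonKerDy : Measurable fun p : ℝ × ℝ => poissonKerDy p.1 p.2 := by
  unfold poissonKerDy; fun_prop

lemma poissonKer_nonneg (s : ℝ) {y : ℝ} (hy : 0 < y) : 0 ≤ poissonKer s y := by
  unfold poissonKer; positivity

lemma poissonKer_pos (s : ℝ) {y : ℝ} (hy : 0 < y) : 0 < poissonKer s y := by
  unfold poissonKer; positivity

lemma abs_poissonKer_le (s : ℝ) {y : ℝ} (hy : 0 < y) :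
    |poissonKer s y| ≤ y * (s ^ 2 + y ^ 2)⁻¹ := by
  rw [abs_of_nonneg (poissonKer_nonneg s hy), poissonKer, div_eq_mul_inv]

lemma abs_poissonKerDx_le (s : ℝ) {y : ℝ} (hy : 0 < y) :
    |poissonKerDx s y| ≤ (s ^ 2 + y ^ 2)⁻¹ := by
  have h := sq_add_sq_pos_of_pos s hy
  rw [poissonKerDx, abs_div, abs_of_pos (pow_pos h 2), div_le_iff₀ (pow_pos h 2), pow_two (_ + _),
    inv_mul_cancel_left₀ h.ne', abs_le]
  constructor <;> nlinarith [sq_nonneg (s + y), sq_nonneg (s - y)]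

lemma abs_poissonKerDy_le (s : ℝ) {y : ℝ} (hy : 0 < y) :
    |poissonKerDy s y| ≤ (s ^ 2 + y ^ 2)⁻¹ := by
  have h := sq_add_sq_pos_of_pos s hy
  rw [poissonKerDy, abs_div, abs_of_pos (pow_pos h 2), div_le_iff₀ (pow_pos h 2), pow_two (_ + _),
    inv_mul_cancel_left₀ h.ne', abs_le]
  constructor <;> nlinarith [sq_nonneg s, sq_nonneg y]

lemma hasDerivAt_poissonKer_fst (t x : ℝ) {y : ℝ} (hy : 0 < y) :
    HasDerivAt (fun x => poissonKer (x - t) y) (poissonKerDx (x - t) y) x := by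
  have h := sq_add_sq_pos_of_pos (x - t) hy
  have hd : HasDerivAt (fun x : ℝ => (x - t) ^ 2 + y ^ 2) (2 * (x - t)) x := by
    simpa using (((hasDerivAt_id x).sub_const t).pow 2).add_const (y ^ 2)
  refine ((hasDerivAt_const x y).div hd h.ne').congr_deriv ?_
  rw [poissonKerDx]; ring

lemma hasDerivAt_poissonKer_snd (s : ℝ) {y : ℝ} (hy : 0 < y) :
    HasDerivAt (fun y => poissonKer s y) (poissonKerDy s y) y := by
  have h := sq_add_sq_pos_of_pos s hy
  have hd : HasDerivAt (fun y : ℝ => s ^ 2 + y ^ 2) (2 * y) y := by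
    simpa using ((hasDerivAt_id y).pow 2).const_add (s ^ 2)
  refine ((hasDerivAt_id y).div hd h.ne').congr_deriv ?_
  simp only [poissonKerDy, id]; ring

lemma inv_sq_add_sq_le (x₀ t : ℝ) {y₀ x y : ℝ} (hy₀ : 0 < y₀) (hx : |x - x₀| ≤ 1)
    (hy : y₀ / 2 < y) :
    ((x - t) ^ 2 + y ^ 2)⁻¹ ≤ (2 + 12 / y₀ ^ 2) * (1 + (x₀ - t) ^ 2)⁻¹ := by
  have hyp : 0 < y := by linarith
  have h := sq_add_sq_pos_of_pos (x - t) hyp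
  have h1 : 0 < 1 + (x₀ - t) ^ 2 := by positivity
  rw [← div_eq_mul_inv, le_div_iff₀ h1, inv_mul_le_iff₀ h]
  have hx2 : (x - x₀) ^ 2 ≤ 1 := by rw [← sq_abs]; nlinarith [abs_nonneg (x - x₀)]
  have hy2 : 3 ≤ 12 / y₀ ^ 2 * y ^ 2 := by
    rw [div_mul_eq_mul_div, le_div_iff₀ (by positivity)]; nlinarith
  have hxt : 0 ≤ 12 / y₀ ^ 2 * (x - t) ^ 2 := by positivity
  nlinarith [sq_nonneg ((x - t) + (x - x₀)), sq_nonneg y]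

lemma integrable_inv_one_add_sub_sq (x : ℝ) : Integrable fun t : ℝ => (1 + (x - t) ^ 2)⁻¹ :=
  integrable_inv_one_add_sq.comp_sub_left x

section Regularity

variable {f : ℝ → ℝ} {K : ℝ → ℝ → ℝ}

lemma integrable_ker_mul (hf : Measurable f) {M : ℝ} (hb : ∀ᵐ t, |f t| ≤ M)
    (hK : Measurable fun p : ℝ × ℝ => K p.1 p.2) {C : ℝ} (x : ℝ) {y : ℝ} (hy : 0 < y)
    (hKb : ∀ s, |K s y| ≤ C * (s ^ 2 + y ^ 2)⁻¹) :
    Integrable fun t => K (x - t) y * f t := by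
  have hC : 0 ≤ C := by
    have := (abs_nonneg _).trans (hKb 0)
    exact nonneg_of_mul_nonneg_left this (by positivity)
  have hKm : Measurable fun t => K (x - t) y := hK.comp (by fun_prop : Measurable fun t => (x - t, y))
  refine Integrable.mono' (((integrable_inv_one_add_sub_sq x).const_mul (2 + 12 / y ^ 2)).const_mul
    (C * M)) (hKm.mul hf).aestronglyMeasurable ?_
  filter_upwards [hb] with t ht
  rw [Real.norm_eq_abs, abs_mul]
  have h1 := inv_sq_add_sq_le x t (x := x) hy (by simp) (by linarith : y / 2 < y)
  calc |K (x - t) y| * |f t| ≤ (C * ((x - t) ^ 2 + y ^ 2)⁻¹) * M := by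
        gcongr; exact hKb _
    _ = C * M * ((x - t) ^ 2 + y ^ 2)⁻¹ := by ring
    _ ≤ _ := by
      have : 0 ≤ M := (abs_nonneg _).trans ht
      gcongr

lemma continuousOn_kerInt (hf : Measurable f) (hb : ∀ᵐ t, |f t| ≤ 1)
    (hK : Measurable fun p : ℝ × ℝ => K p.1 p.2)
    (hKb : ∀ s y, 0 < y → |K s y| ≤ (s ^ 2 + y ^ 2)⁻¹)
    (hKc : ContinuousOn (fun p : ℝ × ℝ => K p.1 p.2) {p | 0 < p.2}) :
    ContinuousOn (fun p : ℝ × ℝ => kerInt K f p.1 p.2) {p | 0 < p.2} := by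
  have hU : IsOpen {p : ℝ × ℝ | 0 < p.2} := isOpen_lt continuous_const continuous_snd
  rintro ⟨x₀, y₀⟩ (hy₀ : 0 < y₀)
  refine ContinuousAt.continuousWithinAt ?_
  refine continuousAt_of_dominated (bound := fun t => (2 + 12 / y₀ ^ 2) * (1 + (x₀ - t) ^ 2)⁻¹)
    ?_ ?_ ((integrable_inv_one_add_sub_sq x₀).const_mul _) ?_
  · refine Eventually.of_forall fun p => ?_
    have : Measurable fun t => K (p.1 - t) p.2 :=
      hK.comp (by fun_prop : Measurable fun t => (p.1 - t, p.2))
    exact (this.mul hf).aestronglyMeasurable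
  · have h1 : ∀ᶠ p : ℝ × ℝ in 𝓝 (x₀, y₀), p.1 ∈ Metric.ball x₀ 1 :=
      continuousAt_fst (Metric.ball_mem_nhds x₀ one_pos)
    have h2 : ∀ᶠ p : ℝ × ℝ in 𝓝 (x₀, y₀), p.2 ∈ Set.Ioi (y₀ / 2) :=
      continuousAt_snd (Ioi_mem_nhds (by dsimp; linarith))
    filter_upwards [h1, h2] with p hp1 hp2
    filter_upwards [hb] with t ht
    have hp2' : y₀ / 2 < p.2 := hp2
    have hp : 0 < p.2 := by linarith
    rw [Real.norm_eq_abs, abs_mul]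
    calc |K (p.1 - t) p.2| * |f t| ≤ ((p.1 - t) ^ 2 + p.2 ^ 2)⁻¹ * 1 := by
          gcongr; exact hKb _ _ hp
      _ ≤ _ := by
        rw [mul_one]
        exact inv_sq_add_sq_le x₀ t hy₀ (by rw [← Real.dist_eq]; exact (Metric.mem_ball.1 hp1).le) hp2
  · refine Eventually.of_forall fun t => ContinuousAt.mul ?_ continuousAt_const
    have hKt : ContinuousAt (fun p : ℝ × ℝ => K p.1 p.2) (x₀ - t, y₀) :=
      hKc.continuousAt (hU.mem_nhds hy₀)
    exact hKt.comp (f := fun p : ℝ × ℝ => (p.1 - t, p.2)) (x := (x₀, y₀)) (by fun_prop)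

lemma hasDerivAt_kerInt_fst (hf : Measurable f) (hb : ∀ᵐ t, |f t| ≤ 1) (x₀ : ℝ) {y : ℝ}
    (hy : 0 < y) :
    HasDerivAt (fun x => kerInt poissonKer f x y) (kerInt poissonKerDx f x₀ y) x₀ := by
  have hm : ∀ {K : ℝ → ℝ → ℝ}, (Measurable fun p : ℝ × ℝ => K p.1 p.2) → ∀ x,
      AEStronglyMeasurable (fun t => K (x - t) y * f t) volume := fun hK x =>
    ((hK.comp (by fun_prop : Measurable fun t => (x - t, y))).mul hf).aestronglyMeasurable
  refine (hasDerivAt_integral_of_dominated_loc_of_deriv_le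
    (bound := fun t => (2 + 12 / y ^ 2) * (1 + (x₀ - t) ^ 2)⁻¹)
    (F' := fun x t => poissonKerDx (x - t) y * f t)
    (Metric.ball_mem_nhds x₀ one_pos) (Eventually.of_forall (hm measurable_poissonKer))
    (integrable_ker_mul hf hb measurable_poissonKer x₀ hy fun s => abs_poissonKer_le s hy)
    (hm measurable_poissonKerDx x₀) ?_ ((integrable_inv_one_add_sub_sq x₀).const_mul _) ?_).2
  · filter_upwards [hb] with t ht x hx
    rw [Real.norm_eq_abs, abs_mul]
    calc |poissonKerDx (x - t) y| * |f t| ≤ ((x - t) ^ 2 + y ^ 2)⁻¹ * 1 := by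
          gcongr; exact abs_poissonKerDx_le _ hy
      _ ≤ _ := by
        rw [mul_one]
        exact inv_sq_add_sq_le x₀ t hy (by rw [← Real.dist_eq]; exact (Metric.mem_ball.1 hx).le)
          (by linarith)
  · exact Eventually.of_forall fun t x _ => (hasDerivAt_poissonKer_fst t x hy).mul_const (f t)

lemma hasDerivAt_kerInt_snd (hf : Measurable f) (hb : ∀ᵐ t, |f t| ≤ 1) (x : ℝ) {y₀ : ℝ}
    (hy₀ : 0 < y₀) :
    HasDerivAt (fun y => kerInt poissonKer f x y) (kerInt poissonKerDy f x y₀) y₀ := by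
  have hm : ∀ {K : ℝ → ℝ → ℝ}, (Measurable fun p : ℝ × ℝ => K p.1 p.2) → ∀ y,
      AEStronglyMeasurable (fun t => K (x - t) y * f t) volume := fun hK y =>
    ((hK.comp (by fun_prop : Measurable fun t => (x - t, y))).mul hf).aestronglyMeasurable
  refine (hasDerivAt_integral_of_dominated_loc_of_deriv_le
    (bound := fun t => (2 + 12 / y₀ ^ 2) * (1 + (x - t) ^ 2)⁻¹)
    (F' := fun y t => poissonKerDy (x - t) y * f t)
    (Ioi_mem_nhds (half_lt_self hy₀)) (Eventually.of_forall (hm measurable_poissonKer))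
    (integrable_ker_mul hf hb measurable_poissonKer x hy₀ fun s => abs_poissonKer_le s hy₀)
    (hm measurable_poissonKerDy y₀) ?_ ((integrable_inv_one_add_sub_sq x).const_mul _) ?_).2
  · filter_upwards [hb] with t ht y hy
    have hy' : y₀ / 2 < y := hy
    rw [Real.norm_eq_abs, abs_mul]
    calc |poissonKerDy (x - t) y| * |f t| ≤ ((x - t) ^ 2 + y ^ 2)⁻¹ * 1 := by
          gcongr; exact abs_poissonKerDy_le _ (by linarith)
      _ ≤ _ := by
        rw [mul_one]
        exact inv_sq_add_sq_le x t hy₀ (by simp) hy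
  · refine Eventually.of_forall fun t y hy => ?_
    have hy' : y₀ / 2 < y := hy
    exact (hasDerivAt_poissonKer_snd (x - t) (by linarith)).mul_const (f t)

end Regularity

lemma kerInt_poissonKer_one (x : ℝ) {y : ℝ} (hy : 0 < y) :
    kerInt poissonKer (fun _ => 1) x y = Real.pi := by
  have h : ∀ u : ℝ, poissonKer u y = y⁻¹ * (1 + (y⁻¹ * u) ^ 2)⁻¹ := fun u => by
    unfold poissonKer; field_simp; ring
  simp only [kerInt, mul_one]
  rw [integral_sub_left_eq_self (fun u => poissonKer u y) volume x]
  simp_rw [h]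
  rw [integral_const_mul, Measure.integral_comp_inv_mul_left (fun u : ℝ => (1 + u ^ 2)⁻¹),
    integral_univ_inv_one_add_sq, abs_of_pos hy, smul_eq_mul, inv_mul_cancel_left₀ hy.ne']

lemma kerInt_poissonKerDx_one (x : ℝ) {y : ℝ} (hy : 0 < y) :
    kerInt poissonKerDx (fun _ => 1) x y = 0 := by
  refine (hasDerivAt_kerInt_fst measurable_const (by simp) x hy).unique ?_
  simp_rw [kerInt_poissonKer_one _ hy]
  exact hasDerivAt_const x _

lemma kerInt_poissonKerDy_one (x : ℝ) {y : ℝ} (hy : 0 < y) :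
    kerInt poissonKerDy (fun _ => 1) x y = 0 := by
  refine (hasDerivAt_kerInt_snd measurable_const (by simp) x hy).unique ?_
  refine (hasDerivAt_const y Real.pi).congr_of_eventuallyEq ?_
  filter_upwards [Ioi_mem_nhds hy] with z hz
  exact kerInt_poissonKer_one x hz

lemma setLIntegral_rpow_mul_sq_add_sq_rpow_le {a b c : ℝ} (hc : 0 < c) (ha : -1 < a) (hb : b ≤ 0)
    (hab : a + 2 * b < -1) :
    ∫⁻ y in Set.Ioi (0 : ℝ), ENNReal.ofReal (y ^ a * (c ^ 2 + y ^ 2) ^ b)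
      ≤ ENNReal.ofReal ((1 / (a + 1) - 1 / (a + 2 * b + 1)) * c ^ (a + 2 * b + 1)) := by
  have hsq : ∀ z : ℝ, 0 < z → (z ^ 2) ^ b = z ^ (2 * b) := fun z hz => by
    rw [← Real.rpow_natCast z 2, ← Real.rpow_mul hz.le]; norm_num
  have h1 : ∫⁻ y in Set.Ioc 0 c, ENNReal.ofReal (y ^ a * (c ^ 2 + y ^ 2) ^ b)
      ≤ ENNReal.ofReal (1 / (a + 1) * c ^ (a + 2 * b + 1)) := by
    have hi : IntegrableOn (fun y : ℝ => y ^ a * c ^ (2 * b)) (Set.Ioc 0 c) :=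
      ((intervalIntegrable_iff_integrableOn_Ioc_of_le hc.le).1
        (intervalIntegral.intervalIntegrable_rpow' ha)).mul_const _
    calc _ ≤ ∫⁻ y in Set.Ioc 0 c, ENNReal.ofReal (y ^ a * c ^ (2 * b)) := by
          refine setLIntegral_mono' measurableSet_Ioc fun y hy => ENNReal.ofReal_le_ofReal ?_
          have := hy.1
          gcongr
          rw [← hsq c hc]
          exact Real.rpow_le_rpow_of_nonpos (by positivity) (by nlinarith) hb
      _ = _ := by
        rw [← ofReal_integral_eq_lintegral_ofReal hi]
        · rw [integral_mul_const, ← intervalIntegral.integral_of_le hc.le,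
            integral_rpow (Or.inl ha), Real.zero_rpow (by linarith), sub_zero,
            show a + 2 * b + 1 = (a + 1) + 2 * b by ring, Real.rpow_add hc (a + 1)]
          ring_nf
        · filter_upwards [ae_restrict_mem measurableSet_Ioc] with y hy
          have := hy.1
          positivity
  have h2 : ∫⁻ y in Set.Ioi c, ENNReal.ofReal (y ^ a * (c ^ 2 + y ^ 2) ^ b)
      ≤ ENNReal.ofReal (-1 / (a + 2 * b + 1) * c ^ (a + 2 * b + 1)) := by
    calc _ ≤ ∫⁻ y in Set.Ioi c, ENNReal.ofReal (y ^ (a + 2 * b)) := by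
          refine setLIntegral_mono' measurableSet_Ioi fun y hy => ENNReal.ofReal_le_ofReal ?_
          have hy0 : 0 < y := hc.trans hy
          rw [Real.rpow_add hy0]
          gcongr
          rw [← hsq y hy0]
          exact Real.rpow_le_rpow_of_nonpos (by positivity) (by nlinarith) hb
      _ = _ := by
        rw [← ofReal_integral_eq_lintegral_ofReal (integrableOn_Ioi_rpow_of_lt hab hc)]
        · rw [integral_Ioi_rpow_of_lt hab hc]
          ring_nf
        · filter_upwards [ae_restrict_mem measurableSet_Ioi] with y hy
          have : 0 < y := hc.trans hy
          positivity
  rw [← Set.Ioc_union_Ioi_eq_Ioi hc.le]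
  refine (lintegral_union_le _ _ _).trans ((add_le_add h1 h2).trans_eq ?_)
  have h3 : 0 < 1 / (a + 1) := by
    have : 0 < a + 1 := by linarith
    positivity
  have h4 : 0 < -1 / (a + 2 * b + 1) := div_pos_of_neg_of_neg (by norm_num) (by linarith)
  rw [← ENNReal.ofReal_add (by positivity) (by positivity)]
  ring_nf

lemma lintegral_sq_add_sq_rpow_le (x : ℝ) {y : ℝ} (hy : 0 < y) :
    ∫⁻ t : ℝ, ENNReal.ofReal (((x - t) ^ 2 + y ^ 2) ^ (-(3 / 4) : ℝ))
      ≤ ENNReal.ofReal (6 * y ^ (-(1 / 2) : ℝ)) := by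
  rw [lintegral_sub_left_eq_self (fun s => ENNReal.ofReal ((s ^ 2 + y ^ 2) ^ (-(3 / 4) : ℝ))) x]
  have hIoi : ∫⁻ s in Set.Ioi (0 : ℝ), ENNReal.ofReal ((s ^ 2 + y ^ 2) ^ (-(3 / 4) : ℝ))
      ≤ ENNReal.ofReal (3 * y ^ (-(1 / 2) : ℝ)) := by
    have := setLIntegral_rpow_mul_sq_add_sq_rpow_le (a := 0) (b := -(3 / 4)) hy (by norm_num)
      (by norm_num) (by norm_num)
    norm_num [add_comm (y ^ 2)] at this ⊢
    exact this
  have hIio : ∫⁻ s in Set.Iio (0 : ℝ), ENNReal.ofReal ((s ^ 2 + y ^ 2) ^ (-(3 / 4) : ℝ))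
      = ∫⁻ s in Set.Ioi (0 : ℝ), ENNReal.ofReal ((s ^ 2 + y ^ 2) ^ (-(3 / 4) : ℝ)) := by
    have := (Measure.measurePreserving_neg (volume : Measure ℝ)).setLIntegral_comp_preimage
      (measurableSet_Ioi (a := (0 : ℝ)))
      (f := fun s => ENNReal.ofReal ((s ^ 2 + y ^ 2) ^ (-(3 / 4) : ℝ))) (by fun_prop)
    simpa using this
  rw [← setLIntegral_univ, ← Set.Iic_union_Ioi (a := (0 : ℝ))]
  refine (lintegral_union_le _ _ _).trans ?_
  rw [setLIntegral_congr Iio_ae_eq_Iic.symm, hIio]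
  refine (add_le_add hIoi hIoi).trans_eq ?_
  rw [← ENNReal.ofReal_add (by positivity) (by positivity)]
  ring_nf

lemma lintegral_mul_sq_le {α : Type*} [MeasurableSpace α] (μ : Measure α) {u w : α → ℝ≥0∞}
    (hu : AEMeasurable u μ) (hw : AEMeasurable w μ) :
    (∫⁻ a, u a * w a ∂μ) ^ 2 ≤ (∫⁻ a, u a ^ 2 ∂μ) * ∫⁻ a, w a ^ 2 ∂μ := by
  have h := ENNReal.lintegral_mul_le_Lp_mul_Lq μ Real.HolderConjugate.two_two hu hw
  have hs : ∀ z : ℝ≥0∞, (z ^ (1 / 2 : ℝ)) ^ 2 = z := fun z => by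
    rw [← ENNReal.rpow_natCast, ← ENNReal.rpow_mul]; norm_num
  calc _ ≤ _ := pow_le_pow_left' h 2
    _ = _ := by rw [mul_pow, hs, hs]; simp

section Energy

variable {f : ℝ → ℝ} {K : ℝ → ℝ → ℝ}

lemma ofReal_kerInt_sq_le (hf : Measurable f) (hb : ∀ᵐ t, |f t| ≤ 1)
    (hK : Measurable fun p : ℝ × ℝ => K p.1 p.2)
    (hKb : ∀ s y, 0 < y → |K s y| ≤ (s ^ 2 + y ^ 2)⁻¹)
    (hK0 : ∀ x y, 0 < y → kerInt K (fun _ => 1) x y = 0) (x : ℝ) {y : ℝ} (hy : 0 < y) :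
    ENNReal.ofReal (kerInt K f x y ^ 2) ≤ ENNReal.ofReal (6 * y ^ (-(1 / 2) : ℝ)) *
      ∫⁻ t, ENNReal.ofReal (((x - t) ^ 2 + y ^ 2) ^ (-(5 / 4) : ℝ) * (f x - f t) ^ 2) := by
  have hKb' : ∀ s, |K s y| ≤ 1 * (s ^ 2 + y ^ 2)⁻¹ := fun s => by simpa using hKb s y hy
  have hrep : kerInt K f x y = ∫ t, K (x - t) y * (f t - f x) := by
    have h0 := hK0 x y hy
    simp only [kerInt, mul_one] at h0
    simp_rw [mul_sub]
    rw [integral_sub (integrable_ker_mul hf hb hK x hy hKb')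
      (integrable_ker_mul measurable_const (M := |f x|) (by simp) hK x hy hKb'),
      integral_mul_const, h0, zero_mul, sub_zero, kerInt]
  have hpow : ∀ {z : ℝ}, 0 < z → ∀ r : ℝ, (z ^ r) ^ 2 = z ^ (2 * r) := fun hz r => by
    rw [← Real.rpow_natCast, ← Real.rpow_mul hz.le]; ring_nf
  have hle : ‖kerInt K f x y‖ₑ ≤ ∫⁻ t, ENNReal.ofReal (((x - t) ^ 2 + y ^ 2) ^ (-(3 / 8) : ℝ)) *
      ENNReal.ofReal (((x - t) ^ 2 + y ^ 2) ^ (-(5 / 8) : ℝ) * |f x - f t|) := by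
    rw [hrep]
    refine (enorm_integral_le_lintegral_enorm _).trans (lintegral_mono fun t => ?_)
    have hp := sq_add_sq_pos_of_pos (x - t) hy
    rw [Real.enorm_eq_ofReal_abs, ← ENNReal.ofReal_mul (by positivity), ← mul_assoc,
      ← Real.rpow_add hp]
    refine ENNReal.ofReal_le_ofReal ?_
    rw [abs_mul, abs_sub_comm (f t)]
    gcongr
    norm_num [Real.rpow_neg_one]
    exact hKb _ _ hy
  calc ENNReal.ofReal (kerInt K f x y ^ 2) = ‖kerInt K f x y‖ₑ ^ 2 := by
        rw [Real.enorm_eq_ofReal_abs, ← ENNReal.ofReal_pow (abs_nonneg _), sq_abs]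
    _ ≤ _ := pow_le_pow_left' hle 2
    _ ≤ _ := lintegral_mul_sq_le volume (by fun_prop) (by fun_prop)
    _ ≤ _ := by
      have e1 : ∀ t, ENNReal.ofReal (((x - t) ^ 2 + y ^ 2) ^ (-(3 / 8) : ℝ)) ^ 2
          = ENNReal.ofReal (((x - t) ^ 2 + y ^ 2) ^ (-(3 / 4) : ℝ)) := fun t => by
        have hp := sq_add_sq_pos_of_pos (x - t) hy
        rw [← ENNReal.ofReal_pow (by positivity), hpow hp]; norm_num
      have e2 : ∀ t, ENNReal.ofReal (((x - t) ^ 2 + y ^ 2) ^ (-(5 / 8) : ℝ) * |f x - f t|) ^ 2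
          = ENNReal.ofReal (((x - t) ^ 2 + y ^ 2) ^ (-(5 / 4) : ℝ) * (f x - f t) ^ 2) := fun t => by
        have hp := sq_add_sq_pos_of_pos (x - t) hy
        rw [← ENNReal.ofReal_pow (by positivity), mul_pow, hpow hp, sq_abs]; norm_num
      simp_rw [e1, e2]
      gcongr
      exact lintegral_sq_add_sq_rpow_le x hy

lemma lintegral_kerInt_sq_le (hf : Measurable f) (hb : ∀ᵐ t, |f t| ≤ 1)
    (hK : Measurable fun p : ℝ × ℝ => K p.1 p.2)
    (hKb : ∀ s y, 0 < y → |K s y| ≤ (s ^ 2 + y ^ 2)⁻¹)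
    (hK0 : ∀ x y, 0 < y → kerInt K (fun _ => 1) x y = 0) :
    ∫⁻ x, ∫⁻ y in Set.Ioi (0 : ℝ), ENNReal.ofReal (kerInt K f x y ^ 2)
      ≤ 15 * ∫⁻ x, ∫⁻ t, ENNReal.ofReal ((f x - f t) ^ 2 / (x - t) ^ 2) := by
  rw [← lintegral_const_mul' _ _ (by norm_num)]
  refine lintegral_mono fun x => ?_
  calc ∫⁻ y in Set.Ioi (0 : ℝ), ENNReal.ofReal (kerInt K f x y ^ 2)
      ≤ ∫⁻ y in Set.Ioi (0 : ℝ), ∫⁻ t, ENNReal.ofReal (6 * y ^ (-(1 / 2) : ℝ)) *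
          ENNReal.ofReal (((x - t) ^ 2 + y ^ 2) ^ (-(5 / 4) : ℝ) * (f x - f t) ^ 2) := by
        refine setLIntegral_mono' measurableSet_Ioi fun y hy => ?_
        rw [lintegral_const_mul' _ _ ENNReal.ofReal_ne_top]
        exact ofReal_kerInt_sq_le hf hb hK hKb hK0 x hy
    _ = ∫⁻ t, ∫⁻ y in Set.Ioi (0 : ℝ), ENNReal.ofReal (6 * y ^ (-(1 / 2) : ℝ)) *
          ENNReal.ofReal (((x - t) ^ 2 + y ^ 2) ^ (-(5 / 4) : ℝ) * (f x - f t) ^ 2) := by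
        refine lintegral_lintegral_swap ?_
        exact Measurable.aemeasurable (by fun_prop)
    _ ≤ ∫⁻ t, 15 * ENNReal.ofReal ((f x - f t) ^ 2 / (x - t) ^ 2) := by
        refine lintegral_mono fun t => ?_
        rcases eq_or_ne x t with rfl | hxt
        · simp
        have hc : 0 < |x - t| := abs_pos.2 (sub_ne_zero.2 hxt)
        have hw := setLIntegral_rpow_mul_sq_add_sq_rpow_le (a := -(1 / 2)) (b := -(5 / 4)) hc
          (by norm_num) (by norm_num) (by norm_num)
        calc _ = ∫⁻ y in Set.Ioi (0 : ℝ), ENNReal.ofReal (6 * (f x - f t) ^ 2) *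
              ENNReal.ofReal (y ^ (-(1 / 2) : ℝ) * (|x - t| ^ 2 + y ^ 2) ^ (-(5 / 4) : ℝ)) := by
              refine setLIntegral_congr_fun measurableSet_Ioi fun y (hy : 0 < y) => ?_
              rw [← ENNReal.ofReal_mul (by positivity), ← ENNReal.ofReal_mul (by positivity),
                sq_abs]
              ring_nf
          _ = ENNReal.ofReal (6 * (f x - f t) ^ 2) * _ :=
              lintegral_const_mul' _ _ ENNReal.ofReal_ne_top
          _ ≤ _ := mul_le_mul' le_rfl hw
          _ = 15 * ENNReal.ofReal ((f x - f t) ^ 2 / (x - t) ^ 2) := by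
              have h15 : (15 : ℝ≥0∞) = ENNReal.ofReal 15 := by norm_num
              have e : |x - t| ^ (-(1 / 2) + 2 * -(5 / 4) + 1 : ℝ) = ((x - t) ^ 2)⁻¹ := by
                norm_num [Real.rpow_neg hc.le]
              rw [h15, ← ENNReal.ofReal_mul (by positivity), ← ENNReal.ofReal_mul (by positivity), e]
              congr 1
              ring
    _ = _ := lintegral_const_mul' _ _ (by norm_num)

end Energy

section Vector

variable {f : ℝ → ℝ} {K : ℝ → ℝ → ℝ}

lemma measurable_kerInt (hf : Measurable f) (hK : Measurable fun p : ℝ × ℝ => K p.1 p.2) :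
    Measurable fun p : ℝ × ℝ => kerInt K f p.1 p.2 := by
  have h : Measurable fun z : (ℝ × ℝ) × ℝ => K (z.1.1 - z.2) z.1.2 * f z.2 :=
    (hK.comp (by fun_prop : Measurable fun z : (ℝ × ℝ) × ℝ => (z.1.1 - z.2, z.1.2))).mul
      (hf.comp measurable_snd)
  exact h.stronglyMeasurable.integral_prod_right.measurable

lemma integrable_poissonKer_mul_sub_sq (hf : Measurable f) (hb : ∀ᵐ t, |f t| ≤ 1) (c x : ℝ)
    {y : ℝ} (hy : 0 < y) : Integrable fun t => poissonKer (x - t) y * (f t - c) ^ 2 := by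
  refine integrable_ker_mul (f := fun t => (f t - c) ^ 2) (M := (1 + |c|) ^ 2) (by fun_prop) ?_
    measurable_poissonKer x hy fun s => abs_poissonKer_le s hy
  filter_upwards [hb] with t ht
  rw [abs_pow]
  gcongr
  exact (abs_sub _ _).trans (by linarith)

lemma integral_poissonKer_mul_sub_sq (hf : Measurable f) (hb : ∀ᵐ t, |f t| ≤ 1) (c x : ℝ)
    {y : ℝ} (hy : 0 < y) :
    ∫ t, poissonKer (x - t) y * (f t - c) ^ 2 =
      kerInt poissonKer (fun t => f t ^ 2) x y - 2 * c * kerInt poissonKer f x y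
        + c ^ 2 * Real.pi := by
  have i0 := integrable_poissonKer_mul_sub_sq hf hb 0 x hy
  simp only [sub_zero] at i0
  have i1 := integrable_ker_mul hf hb measurable_poissonKer x hy fun s => abs_poissonKer_le s hy
  have i2 := integrable_ker_mul (f := fun _ => 1) (M := 1) measurable_const (by simp)
    measurable_poissonKer x hy fun s => abs_poissonKer_le s hy
  have i01 : Integrable fun t =>
      poissonKer (x - t) y * f t ^ 2 - 2 * c * (poissonKer (x - t) y * f t) :=
    i0.sub (i1.const_mul (2 * c))
  rw [← kerInt_poissonKer_one x hy]
  simp only [kerInt]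
  rw [← integral_const_mul, ← integral_const_mul, ← integral_sub i0 (i1.const_mul _),
    ← integral_add i01 (i2.const_mul _)]
  congr 1 with t
  ring

/-- If the Poisson extension of `f` is equal to `P` along the whole vertical line over `x` and the
energy density of `f` at `x` is finite, then `f x = P`. -/
lemma eq_of_kerInt_poissonKer_eq (hf : Measurable f) (hb : ∀ᵐ t, |f t| ≤ 1) {x P : ℝ}
    (hfin : ∫⁻ t, ENNReal.ofReal ((f x - f t) ^ 2 / (x - t) ^ 2) < ⊤)
    (hP : ∀ y, 0 < y → kerInt poissonKer f x y = Real.pi * P) : f x = P := by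
  have hint : Integrable fun t => (f x - f t) ^ 2 / (x - t) ^ 2 := by
    refine ⟨Measurable.aestronglyMeasurable (by fun_prop), ?_⟩
    rw [hasFiniteIntegral_iff_ofReal (Eventually.of_forall fun t => by positivity)]
    exact hfin
  set M := ∫ t, (f x - f t) ^ 2 / (x - t) ^ 2
  have hle : ∀ y, 0 < y → Real.pi * (P - f x) ^ 2 ≤ y * M := fun y hy => by
    have h1 : 0 ≤ ∫ t, poissonKer (x - t) y * (f t - P) ^ 2 :=
      integral_nonneg fun t => mul_nonneg (poissonKer_nonneg _ hy) (sq_nonneg _)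
    have h2 : ∫ t, poissonKer (x - t) y * (f t - f x) ^ 2 ≤ y * M := by
      rw [← integral_const_mul]
      refine integral_mono (integrable_poissonKer_mul_sub_sq hf hb _ x hy) (hint.const_mul y)
        fun t => ?_
      rcases eq_or_ne x t with rfl | hxt
      · simp
      have hs : 0 < (x - t) ^ 2 := by have := sub_ne_zero.2 hxt; positivity
      have : poissonKer (x - t) y ≤ y / (x - t) ^ 2 := by
        unfold poissonKer; gcongr; nlinarith
      calc poissonKer (x - t) y * (f t - f x) ^ 2 ≤ y / (x - t) ^ 2 * (f t - f x) ^ 2 := by gcongr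
        _ = y * ((f x - f t) ^ 2 / (x - t) ^ 2) := by ring
    rw [integral_poissonKer_mul_sub_sq hf hb _ x hy, hP y hy] at h1 h2
    nlinarith
  have hlim : Tendsto (fun y : ℝ => y * M) (𝓝[>] 0) (𝓝 0) := by
    have : Tendsto (fun y : ℝ => y * M) (𝓝 0) (𝓝 (0 * M)) := tendsto_id.mul_const M
    rw [zero_mul] at this
    exact this.mono_left nhdsWithin_le_nhds
  have h0 : Real.pi * (P - f x) ^ 2 ≤ 0 :=
    ge_of_tendsto hlim (by filter_upwards [self_mem_nhdsWithin] with y hy using hle y hy)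
  have h1 : (P - f x) ^ 2 ≤ 0 := by
    by_contra! h
    exact absurd h0 (not_le.2 (mul_pos Real.pi_pos h))
  nlinarith [sq_nonneg (P - f x)]

/-- The componentwise integral of `Q` against the normalised kernel `π⁻¹ K`. -/
def kerExt (K : ℝ → ℝ → ℝ) (Q : ℝ → V3) (x y : ℝ) : V3 :=
  fun i => Real.pi⁻¹ * kerInt K (fun t => Q t i) x y

variable {Q : ℝ → V3}

lemma measurable_kerExt (hQ : Measurable Q) (hK : Measurable fun p : ℝ × ℝ => K p.1 p.2) (i : Fin 3) :
    Measurable fun p : ℝ × ℝ => kerExt K Q p.1 p.2 i :=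
  (measurable_kerInt (by fun_prop) hK).const_mul _

lemma ae_abs_apply_le_one (hs : ∀ᵐ x : ℝ, ∑ i, (Q x i) ^ 2 = 1) (i : Fin 3) :
    ∀ᵐ t, |Q t i| ≤ 1 := by
  filter_upwards [hs] with t ht
  rw [← sq_le_one_iff_abs_le_one, ← ht]
  exact Finset.single_le_sum (f := fun j => Q t j ^ 2) (fun j _ => sq_nonneg _) (Finset.mem_univ i)

lemma poissonExt_eq_kerExt (hQ : Measurable Q) (hb : ∀ i, ∀ᵐ t, |Q t i| ≤ 1) (x : ℝ) {y : ℝ}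
    (hy : 0 < y) : poissonExt Q x y = kerExt poissonKer Q x y := by
  ext i
  rw [poissonExt, Pi.smul_apply, eval_integral fun j => ?_]
  · rfl
  · exact integrable_ker_mul (by fun_prop : Measurable fun t => Q t j) (hb j)
      measurable_poissonKer x hy fun s => abs_poissonKer_le s hy

lemma hasDerivAt_poissonExt_fst (hQ : Measurable Q) (hb : ∀ i, ∀ᵐ t, |Q t i| ≤ 1) (x : ℝ) {y : ℝ}
    (hy : 0 < y) : HasDerivAt (fun s => poissonExt Q s y) (kerExt poissonKerDx Q x y) x := by
  simp_rw [poissonExt_eq_kerExt hQ hb _ hy]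
  exact hasDerivAt_pi.2 fun i => (hasDerivAt_kerInt_fst (by fun_prop) (hb i) x hy).const_mul _

lemma hasDerivAt_poissonExt_snd (hQ : Measurable Q) (hb : ∀ i, ∀ᵐ t, |Q t i| ≤ 1) (x : ℝ) {y : ℝ}
    (hy : 0 < y) : HasDerivAt (fun s => poissonExt Q x s) (kerExt poissonKerDy Q x y) y := by
  have h : HasDerivAt (fun s => kerExt poissonKer Q x s) (kerExt poissonKerDy Q x y) y :=
    hasDerivAt_pi.2 fun i => (hasDerivAt_kerInt_snd (by fun_prop) (hb i) x hy).const_mul _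
  refine h.congr_of_eventuallyEq ?_
  filter_upwards [Ioi_mem_nhds hy] with s hs using poissonExt_eq_kerExt hQ hb x hs

/-- Strong maximum principle for sphere-valued boundary data. -/
lemma sum_kerExt_sq_lt_one_or_ae_eq (hQ : Measurable Q) (hs : ∀ᵐ x : ℝ, ∑ i, (Q x i) ^ 2 = 1)
    (x : ℝ) {y : ℝ} (hy : 0 < y) :
    ∑ i, kerExt poissonKer Q x y i ^ 2 < 1 ∨ ∀ᵐ t, Q t = kerExt poissonKer Q x y := by
  have hb := ae_abs_apply_le_one hs
  have hQi : ∀ i, Measurable fun t => Q t i := fun i => by fun_prop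
  set e := kerExt poissonKer Q x y with he
  have hei : ∀ i, kerInt poissonKer (fun t => Q t i) x y = Real.pi * e i := fun i => by
    rw [he, kerExt, mul_inv_cancel_left₀ Real.pi_ne_zero]
  have hi : ∀ i, Integrable fun t => poissonKer (x - t) y * (Q t i - e i) ^ 2 := fun i =>
    integrable_poissonKer_mul_sub_sq (hQi i) (hb i) (e i) x hy
  have hisum : Integrable fun t => ∑ i, poissonKer (x - t) y * (Q t i - e i) ^ 2 :=
    integrable_finsetSum _ fun i _ => hi i
  have hsq : ∑ i, kerInt poissonKer (fun t => Q t i ^ 2) x y = Real.pi := by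
    rw [← kerInt_poissonKer_one x hy]
    simp only [kerInt]
    rw [← integral_finsetSum _ fun i _ => ?_]
    · refine integral_congr_ae ?_
      filter_upwards [hs] with t ht
      rw [← Finset.mul_sum, ht]
    · simpa using integrable_poissonKer_mul_sub_sq (hQi i) (hb i) 0 x hy
  have hvar : ∫ t, ∑ i, poissonKer (x - t) y * (Q t i - e i) ^ 2
      = Real.pi * (1 - ∑ i, e i ^ 2) := by
    rw [integral_finsetSum _ fun i _ => hi i]
    simp_rw [fun i => integral_poissonKer_mul_sub_sq (hQi i) (hb i) (e i) x hy, hei]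
    rw [Finset.sum_add_distrib, Finset.sum_sub_distrib, hsq, mul_sub, mul_one, Finset.mul_sum,
      sub_add, ← Finset.sum_sub_distrib]
    congr 2 with i
    ring
  have hnn : ∀ t, 0 ≤ ∑ i, poissonKer (x - t) y * (Q t i - e i) ^ 2 := fun t =>
    Finset.sum_nonneg fun i _ => mul_nonneg (poissonKer_nonneg _ hy) (sq_nonneg _)
  rw [or_iff_not_imp_left, not_lt]
  intro h1
  have h0 : ∫ t, ∑ i, poissonKer (x - t) y * (Q t i - e i) ^ 2 = 0 := by
    refine le_antisymm ?_ (integral_nonneg hnn)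
    rw [hvar]
    exact mul_nonpos_of_nonneg_of_nonpos Real.pi_pos.le (by linarith)
  filter_upwards [(integral_eq_zero_iff_of_nonneg hnn hisum).1 h0] with t ht
  ext i
  have hti := (Finset.sum_eq_zero_iff_of_nonneg fun i _ =>
    mul_nonneg (poissonKer_nonneg (x - t) hy) (sq_nonneg (Q t i - e i))).1 ht i (Finset.mem_univ i)
  have := (mul_eq_zero.1 hti).resolve_left (poissonKer_pos _ hy).ne'
  exact sub_eq_zero.1 (pow_eq_zero_iff two_ne_zero |>.1 this)

end Vector

lemma two_mul_abs_dot3_cross3_le (q a b : V3) :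
    2 * |dot3 (cross3 q a) b| ≤ √(∑ i, q i ^ 2) * (∑ i, a i ^ 2 + ∑ i, b i ^ 2) := by
  have hsq : dot3 (cross3 q a) b ^ 2 ≤ (∑ i, q i ^ 2) * ((∑ i, a i ^ 2) * ∑ i, b i ^ 2) := by
    have h1 : dot3 (cross3 q a) b ^ 2 ≤ (∑ i, cross3 q a i ^ 2) * ∑ i, b i ^ 2 :=
      Finset.sum_mul_sq_le_sq_mul_sq _ _ _
    have h2 : ∑ i, cross3 q a i ^ 2 ≤ (∑ i, q i ^ 2) * ∑ i, a i ^ 2 := by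
      simp only [cross3, cross_apply, Fin.sum_univ_three, Matrix.cons_val_zero, Matrix.cons_val_one,
        Matrix.cons_val]
      nlinarith [sq_nonneg (q 0 * a 0 + q 1 * a 1 + q 2 * a 2)]
    rw [← mul_assoc]
    exact h1.trans (mul_le_mul_of_nonneg_right h2 (Finset.sum_nonneg fun i _ => sq_nonneg _))
  have hq : 0 ≤ ∑ i, q i ^ 2 := Finset.sum_nonneg fun i _ => sq_nonneg _
  have ha : 0 ≤ ∑ i, a i ^ 2 := Finset.sum_nonneg fun i _ => sq_nonneg _
  have hb : 0 ≤ ∑ i, b i ^ 2 := Finset.sum_nonneg fun i _ => sq_nonneg _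
  refine abs_le_of_sq_le_sq' ?_ (by positivity) |>.2
  rw [mul_pow, mul_pow, sq_abs, Real.sq_sqrt hq]
  nlinarith [mul_nonneg hq (sq_nonneg (∑ i, a i ^ 2 - ∑ i, b i ^ 2))]

section Energy

variable {Q : ℝ → V3} {K : ℝ → ℝ → ℝ}

lemma lintegral_component_lt_top (i : Fin 3) (henergy :
      (∫⁻ x : ℝ, ∫⁻ y : ℝ,
        ENNReal.ofReal ((∑ i, (Q x i - Q y i) ^ 2) / (x - y) ^ 2)) < ⊤) :
    ∫⁻ x : ℝ, ∫⁻ y : ℝ, ENNReal.ofReal ((Q x i - Q y i) ^ 2 / (x - y) ^ 2) < ⊤ := by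
  refine lt_of_le_of_lt (lintegral_mono fun x => lintegral_mono fun y =>
    ENNReal.ofReal_le_ofReal ?_) henergy
  gcongr
  exact Finset.single_le_sum (f := fun j => (Q x j - Q y j) ^ 2) (fun j _ => sq_nonneg _)
    (Finset.mem_univ i)

lemma integrable_kerExt_sq (hQ : Measurable Q) (hb : ∀ i, ∀ᵐ t, |Q t i| ≤ 1)
    (henergy : (∫⁻ x : ℝ, ∫⁻ y : ℝ,
        ENNReal.ofReal ((∑ i, (Q x i - Q y i) ^ 2) / (x - y) ^ 2)) < ⊤)
    (hK : Measurable fun p : ℝ × ℝ => K p.1 p.2)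
    (hKb : ∀ s y, 0 < y → |K s y| ≤ (s ^ 2 + y ^ 2)⁻¹)
    (hK0 : ∀ x y, 0 < y → kerInt K (fun _ => 1) x y = 0) :
    Integrable (fun p : ℝ × ℝ => ∑ i, kerExt K Q p.1 p.2 i ^ 2)
      ((volume : Measure ℝ).prod (volume.restrict (Set.Ioi 0))) := by
  refine integrable_finsetSum _ fun i _ => ?_
  have hQi : Measurable fun t => Q t i := by fun_prop
  have hm := measurable_kerInt hQi hK
  simp only [kerExt, mul_pow]
  refine Integrable.const_mul ⟨(hm.pow_const 2).aestronglyMeasurable, ?_⟩ _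
  rw [hasFiniteIntegral_iff_ofReal (Eventually.of_forall fun p => sq_nonneg _),
    lintegral_prod _ (by fun_prop)]
  exact (lintegral_kerInt_sq_le hQi (hb i) hK hKb hK0).trans_lt
    (ENNReal.mul_lt_top (by norm_num) (lintegral_component_lt_top i henergy))

/-- If the Poisson extension of a map of finite energy is critical everywhere, the map is constant
almost everywhere. -/
lemma ae_eq_of_kerExt_eq_zero (hQ : Measurable Q) (hb : ∀ i, ∀ᵐ t, |Q t i| ≤ 1)
    (henergy : (∫⁻ x : ℝ, ∫⁻ y : ℝ,
        ENNReal.ofReal ((∑ i, (Q x i - Q y i) ^ 2) / (x - y) ^ 2)) < ⊤)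
    (hx : ∀ x y, 0 < y → kerExt poissonKerDx Q x y = 0)
    (hy : ∀ x y, 0 < y → kerExt poissonKerDy Q x y = 0) :
    ∀ᵐ x, Q x = kerExt poissonKer Q 0 1 := by
  have hQi : ∀ i, Measurable fun t => Q t i := fun i => by fun_prop
  have hcomp : ∀ i, ∀ᵐ x, Q x i = kerExt poissonKer Q 0 1 i := fun i => by
    have hzero : ∀ {K : ℝ → ℝ → ℝ} {x y : ℝ}, kerExt K Q x y = 0 →
        kerInt K (fun t => Q t i) x y = 0 := fun h =>
      (mul_eq_zero.1 (congrFun h i)).resolve_left (inv_ne_zero Real.pi_ne_zero)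
    have hdx : ∀ x y, 0 < y → HasDerivAt (fun s => kerInt poissonKer (fun t => Q t i) s y) 0 x :=
      fun x y h => hzero (hx x y h) ▸ hasDerivAt_kerInt_fst (hQi i) (hb i) x h
    have hdy : ∀ x y, 0 < y → HasDerivAt (fun s => kerInt poissonKer (fun t => Q t i) x s) 0 y :=
      fun x y h => hzero (hy x y h) ▸ hasDerivAt_kerInt_snd (hQi i) (hb i) x h
    have hconst : ∀ x y, 0 < y → kerInt poissonKer (fun t => Q t i) x y
        = kerInt poissonKer (fun t => Q t i) 0 1 := fun x y h => by
      rw [is_const_of_deriv_eq_zero (fun x => (hdx x y h).differentiableAt)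
        (fun x => (hdx x y h).deriv) x 0]
      exact isOpen_Ioi.is_const_of_deriv_eq_zero (convex_Ioi (0 : ℝ)).isPreconnected
        (fun y h => (hdy 0 y h).differentiableAt.differentiableWithinAt)
        (fun y h => (hdy 0 y h).deriv) h (Set.mem_Ioi.2 one_pos)
    have hlt := ae_lt_top (Measurable.lintegral_prod_right (by fun_prop))
      (lintegral_component_lt_top i henergy).ne
    filter_upwards [hlt] with x hxfin
    refine eq_of_kerInt_poissonKer_eq (hQi i) (hb i) hxfin fun y h => ?_
    rw [hconst x y h, kerExt, mul_inv_cancel_left₀ Real.pi_ne_zero]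
  filter_upwards [ae_all_iff.2 hcomp] with x h using funext h

lemma kerExt_eq_zero_of_ae_eq {P : V3} (hP : ∀ᵐ t, Q t = P)
    (hK0 : ∀ x y, 0 < y → kerInt K (fun _ => 1) x y = 0) (x : ℝ) {y : ℝ} (hy : 0 < y) :
    kerExt K Q x y = 0 := by
  ext i
  have h : kerInt K (fun t => Q t i) x y = P i * kerInt K (fun _ => 1) x y := by
    simp only [kerInt, mul_one]
    rw [← integral_const_mul]
    refine integral_congr_ae ?_
    filter_upwards [hP] with t ht
    rw [ht, mul_comm]
  rw [kerExt, h, hK0 x y hy]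
  simp

lemma kerExt_eq_zero_of_ae_eq_zero (hQ : Measurable Q) (hb : ∀ i, ∀ᵐ t, |Q t i| ≤ 1)
    (hK : Measurable fun p : ℝ × ℝ => K p.1 p.2)
    (hKb : ∀ s y, 0 < y → |K s y| ≤ (s ^ 2 + y ^ 2)⁻¹)
    (hKc : ContinuousOn (fun p : ℝ × ℝ => K p.1 p.2) {p | 0 < p.2})
    (h : ∀ᵐ p : ℝ × ℝ ∂volume.restrict {p | 0 < p.2}, ∑ i, kerExt K Q p.1 p.2 i ^ 2 = 0)
    (x : ℝ) {y : ℝ} (hy : 0 < y) : kerExt K Q x y = 0 := by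
  ext i
  have hae : (fun p : ℝ × ℝ => kerExt K Q p.1 p.2 i) =ᵐ[volume.restrict {p | 0 < p.2}]
      fun _ => 0 := by
    filter_upwards [h] with p hp
    exact pow_eq_zero_iff two_ne_zero |>.1
      ((Finset.sum_eq_zero_iff_of_nonneg fun i _ => sq_nonneg _).1 hp i (Finset.mem_univ i))
  exact Measure.eqOn_open_of_ae_eq hae (isOpen_lt continuous_const continuous_snd)
    (continuousOn_const.mul (continuousOn_kerInt (by fun_prop) (hb i) hK hKb hKc))
    continuousOn_const (x := (x, y)) hy

end Energy

lemma continuousOn_poissonKerDx :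
    ContinuousOn (fun p : ℝ × ℝ => poissonKerDx p.1 p.2) {p | 0 < p.2} := by
  unfold poissonKerDx
  exact ContinuousOn.div (by fun_prop) (by fun_prop)
    fun p hp => pow_ne_zero 2 (sq_add_sq_pos_of_pos p.1 hp).ne'

lemma continuousOn_poissonKerDy :
    ContinuousOn (fun p : ℝ × ℝ => poissonKerDy p.1 p.2) {p | 0 < p.2} := by
  unfold poissonKerDy
  exact ContinuousOn.div (by fun_prop) (by fun_prop)
    fun p hp => pow_ne_zero 2 (sq_add_sq_pos_of_pos p.1 hp).ne'

/-- If `G ≥ 0` and `|H| ≤ θ G` pointwise for some `θ < 1`, possibly depending on the point, then an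
identity `v ∫ G = ∫ H` with `|v| ≥ 1` forces `G` to vanish. -/
lemma ae_eq_zero_of_mul_integral_eq {α : Type*} [MeasurableSpace α] {μ : Measure α} {G H θ : α → ℝ}
    {v : ℝ} (hv : 1 ≤ |v|) (hG : Integrable G μ) (hH : AEStronglyMeasurable H μ)
    (hG0 : ∀ᵐ p ∂μ, 0 ≤ G p) (hHG : ∀ᵐ p ∂μ, |H p| ≤ θ p * G p) (hθ : ∀ᵐ p ∂μ, θ p < 1)
    (h : v * ∫ p, G p ∂μ = ∫ p, H p ∂μ) : ∀ᵐ p ∂μ, G p = 0 := by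
  have hle : ∀ᵐ p ∂μ, |H p| ≤ G p := by
    filter_upwards [hG0, hHG, hθ] with p h0 h1 h2
    nlinarith
  have hHi : Integrable H μ := hG.mono' hH hle
  have hD0 : 0 ≤ᵐ[μ] fun p => G p - |H p| := by
    filter_upwards [hle] with p hp using sub_nonneg.2 hp
  have hD : ∫ p, G p - |H p| ∂μ = 0 := by
    refine le_antisymm ?_ (integral_nonneg_of_ae hD0)
    rw [integral_sub hG hHi.abs, sub_nonpos]
    calc ∫ p, G p ∂μ = 1 * |∫ p, G p ∂μ| := by
          rw [one_mul, abs_of_nonneg (integral_nonneg_of_ae hG0)]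
      _ ≤ |v| * |∫ p, G p ∂μ| := by gcongr
      _ = |∫ p, H p ∂μ| := by rw [← abs_mul, h]
      _ ≤ _ := abs_integral_le_integral_abs
  filter_upwards [(integral_eq_zero_iff_of_nonneg_ae hD0 (hG.sub hHi.abs)).1 hD, hG0, hHG, hθ]
    with p h0 h1 h2 h3
  have h0' : G p - |H p| = 0 := h0
  nlinarith

/-- **Rigidity for `|v| ≥ 1` via the Pohozaev identity.**  Let `Q ∈ Ḣ^{1/2}(ℝ;ℝ³)`
with `|Q| = 1` a.e. (so that `|Q^e| ≤ 1` by the maximum principle).  If `|v| ≥ 1`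
and the Pohozaev identity
`v ∬_{ℝ²₊} (|∂ₓQ^e|² + |∂ᵧQ^e|²) = 2 ∬_{ℝ²₊} (Q^e × ∂ₓQ^e)·∂ᵧQ^e`
holds, then `∂ₓQ^e ≡ 0` and `∂ᵧQ^e ≡ 0` on `ℝ²₊`, and `Q` is constant a.e. -/
theorem pohozaev_rigidity_superluminal
    (v : ℝ) (hv : 1 ≤ |v|) (Q : ℝ → V3)
    (hmeas : Measurable Q)
    (hsphere : ∀ᵐ x : ℝ, ∑ i, (Q x i) ^ 2 = 1)
    (henergy :
      (∫⁻ x : ℝ, ∫⁻ y : ℝ,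
        ENNReal.ofReal ((∑ i, (Q x i - Q y i) ^ 2) / (x - y) ^ 2)) < ⊤)
    (hpoho :
      v * ∫ x : ℝ, ∫ y in Set.Ioi (0 : ℝ),
          ((∑ i, (deriv (fun s => poissonExt Q s y) x i) ^ 2)
            + ∑ i, (deriv (fun s => poissonExt Q x s) y i) ^ 2)
        = 2 * ∫ x : ℝ, ∫ y in Set.Ioi (0 : ℝ),
            dot3 (cross3 (poissonExt Q x y) (deriv (fun s => poissonExt Q s y) x))
              (deriv (fun s => poissonExt Q x s) y)) :
    (∀ x y : ℝ, 0 < y →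
      deriv (fun s => poissonExt Q s y) x = 0 ∧
      deriv (fun s => poissonExt Q x s) y = 0) ∧
    ∃ P : V3, ∀ᵐ x : ℝ, Q x = P := by
  have hb := ae_abs_apply_le_one hsphere
  have hdx := fun x y (hy : 0 < y) => (hasDerivAt_poissonExt_fst hmeas hb x hy).deriv
  have hdy := fun x y (hy : 0 < y) => (hasDerivAt_poissonExt_snd hmeas hb x hy).deriv
  have hDx0 := fun x y (hy : 0 < y) => kerInt_poissonKerDx_one x hy
  have hDy0 := fun x y (hy : 0 < y) => kerInt_poissonKerDy_one x hy
  have hDxb := fun s y (hy : 0 < y) => abs_poissonKerDx_le s hy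
  have hDyb := fun s y (hy : 0 < y) => abs_poissonKerDy_le s hy
  suffices hgrad : (∀ x y, 0 < y → kerExt poissonKerDx Q x y = 0) ∧
      ∀ x y, 0 < y → kerExt poissonKerDy Q x y = 0 from
    ⟨fun x y hy => ⟨(hdx x y hy).trans (hgrad.1 x y hy), (hdy x y hy).trans (hgrad.2 x y hy)⟩,
      _, ae_eq_of_kerExt_eq_zero hmeas hb henergy hgrad.1 hgrad.2⟩
  by_cases hconst : ∃ P : V3, ∀ᵐ t, Q t = P
  · obtain ⟨P, hP⟩ := hconst
    exact ⟨fun x y => kerExt_eq_zero_of_ae_eq hP hDx0 x,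
      fun x y => kerExt_eq_zero_of_ae_eq hP hDy0 x⟩
  set μ := (volume : Measure ℝ).prod (volume.restrict (Set.Ioi (0 : ℝ))) with hμ
  have hμ' : μ = volume.restrict {p : ℝ × ℝ | 0 < p.2} := by
    have : {p : ℝ × ℝ | 0 < p.2} = Set.univ ×ˢ Set.Ioi 0 := by ext; simp
    rw [this, Measure.volume_eq_prod, ← Measure.prod_restrict, Measure.restrict_univ]
  have hpos : ∀ᵐ p ∂μ, 0 < p.2 := by
    rw [hμ']
    exact ae_restrict_mem (measurableSet_lt measurable_const measurable_snd)
  set G : ℝ × ℝ → ℝ := fun p => ∑ i, kerExt poissonKerDx Q p.1 p.2 i ^ 2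
    + ∑ i, kerExt poissonKerDy Q p.1 p.2 i ^ 2 with hGdef
  set H : ℝ × ℝ → ℝ := fun p => 2 * dot3 (cross3 (kerExt poissonKer Q p.1 p.2)
    (kerExt poissonKerDx Q p.1 p.2)) (kerExt poissonKerDy Q p.1 p.2) with hHdef
  have hGi : Integrable G μ :=
    (integrable_kerExt_sq hmeas hb henergy measurable_poissonKerDx hDxb hDx0).add
      (integrable_kerExt_sq hmeas hb henergy measurable_poissonKerDy hDyb hDy0)
  have hHm : Measurable H := by
    have m0 := measurable_kerExt hmeas measurable_poissonKer
    have m1 := measurable_kerExt hmeas measurable_poissonKerDx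
    have m2 := measurable_kerExt hmeas measurable_poissonKerDy
    simp only [hHdef, dot3, cross3, cross_apply, Fin.sum_univ_three, Matrix.cons_val_zero,
      Matrix.cons_val_one, Matrix.cons_val]
    fun_prop
  have hG0 : ∀ p, 0 ≤ G p := fun p => by positivity
  have hHG : ∀ p, |H p| ≤ √(∑ i, kerExt poissonKer Q p.1 p.2 i ^ 2) * G p := fun p => by
    rw [hHdef, abs_mul, abs_two]
    exact two_mul_abs_dot3_cross3_le _ _ _
  have hθ : ∀ᵐ p ∂μ, √(∑ i, kerExt poissonKer Q p.1 p.2 i ^ 2) < 1 := by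
    filter_upwards [hpos] with p hp
    rw [Real.sqrt_lt' one_pos, one_pow]
    exact (sum_kerExt_sq_lt_one_or_ae_eq hmeas hsphere p.1 hp).resolve_right
      fun h => hconst ⟨_, h⟩
  have hHi : Integrable H μ := by
    refine hGi.mono' hHm.aestronglyMeasurable ?_
    filter_upwards [hθ] with p hp
    exact (hHG p).trans (mul_le_of_le_one_left (hG0 p) hp.le)
  have hid : v * ∫ p, G p ∂μ = ∫ p, H p ∂μ := by
    rw [hμ, integral_prod _ hGi, integral_prod _ hHi]
    simp only [hGdef, hHdef, integral_const_mul]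
    refine Eq.trans ?_ (hpoho.trans ?_)
    · refine congrArg (v * ·) (integral_congr_ae (Eventually.of_forall fun x =>
        setIntegral_congr_fun measurableSet_Ioi fun y hy => ?_))
      simp only [hdx x y hy, hdy x y hy]
    · refine congrArg (2 * ·) (integral_congr_ae (Eventually.of_forall fun x =>
        setIntegral_congr_fun measurableSet_Ioi fun y hy => ?_))
      simp only [hdx x y hy, hdy x y hy, poissonExt_eq_kerExt hmeas hb x hy]
  have hGz := ae_eq_zero_of_mul_integral_eq hv hGi hHm.aestronglyMeasurable
    (Eventually.of_forall hG0) (Eventually.of_forall hHG) hθ hid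
  rw [hμ'] at hGz
  have hsplit : ∀ p, G p = 0 → ∑ i, kerExt poissonKerDx Q p.1 p.2 i ^ 2 = 0 ∧
      ∑ i, kerExt poissonKerDy Q p.1 p.2 i ^ 2 = 0 := fun p hp =>
    (add_eq_zero_iff_of_nonneg (Finset.sum_nonneg fun i _ => sq_nonneg _)
      (Finset.sum_nonneg fun i _ => sq_nonneg _)).1 hp
  exact ⟨fun x y => kerExt_eq_zero_of_ae_eq_zero hmeas hb measurable_poissonKerDx hDxb
      continuousOn_poissonKerDx (hGz.mono fun p hp => (hsplit p hp).1) x,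
    fun x y => kerExt_eq_zero_of_ae_eq_zero hmeas hb measurable_poissonKerDy hDyb
      continuousOn_poissonKerDy (hGz.mono fun p hp => (hsplit p hp).2) x⟩
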